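/- Let ρ > 0, σ > 0, μ₀ ≥ 0, α_μ ∈ ℝ, and let PN(m) denote the projected normal density on [0, 2π) with parameters (μ₀, α_μ, σ). Then ∫_{0}^{2π} ∫_{0}^{2π} cos(y − α_μ) · vM(y | m, ρ) · PN(m) dm dy = (I_1(ρ)/I_0(ρ)) · √(πβ/2) · e^{−β} · (I_0(β) + I_1(β)), where β = μ₀²/(4σ²). Consequently the circular variance of the SvM observation Y equals 1 − (I_1(ρ)/I_0(ρ)) √(πβ/2) e^{−β}(I_0(β) + I_1(β)). -/

import Mathlib

open MeasureTheory

/-- standard normal density -/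
noncomputable def stdPhi (x : ℝ) : ℝ := (Real.sqrt (2 * Real.pi))⁻¹ * Real.exp (-x ^ 2 / 2)

/-- standard normal CDF -/
noncomputable def stdPhiCDF (x : ℝ) : ℝ := ∫ t in Set.Iic x, stdPhi t

/-- modified Bessel function of the first kind of integer order -/
noncomputable def besselI (n : ℕ) (ρ : ℝ) : ℝ :=
  (1 / (2 * Real.pi)) * ∫ y in (0:ℝ)..(2 * Real.pi), Real.cos (n * y) * Real.exp (ρ * Real.cos y)

/-- von Mises density with mean angle m and concentration ρ -/
noncomputable def vM (y m ρ : ℝ) : ℝ :=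
  Real.exp (ρ * Real.cos (y - m)) / (2 * Real.pi * besselI 0 ρ)

/-- projected normal density on [0, 2π) with parameters μ₀ ≥ 0, α, σ > 0 -/
noncomputable def projNormal (μ₀ α σ m : ℝ) : ℝ :=
  stdPhi (μ₀ * Real.sin (m - α) / σ) *
    (stdPhi (μ₀ * Real.cos (m - α) / σ) +
      (μ₀ * Real.cos (m - α) / σ) * stdPhiCDF (μ₀ * Real.cos (m - α) / σ))

lemma stdPhi_eq_gaussianPDFReal : stdPhi = ProbabilityTheory.gaussianPDFReal 0 1 := by
  ext x
  simp [stdPhi, ProbabilityTheory.gaussianPDFReal]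

lemma integrable_stdPhi : Integrable stdPhi := by
  rw [stdPhi_eq_gaussianPDFReal]
  exact ProbabilityTheory.integrable_gaussianPDFReal 0 1

lemma integral_stdPhi : ∫ t, stdPhi t = 1 := by
  rw [stdPhi_eq_gaussianPDFReal]
  exact ProbabilityTheory.integral_gaussianPDFReal_eq_one 0 one_ne_zero

@[fun_prop]
lemma continuous_stdPhi : Continuous stdPhi := by
  unfold stdPhi
  fun_prop

lemma stdPhi_neg (x : ℝ) : stdPhi (-x) = stdPhi x := by
  simp [stdPhi]

@[fun_prop]
lemma continuous_stdPhiCDF : Continuous stdPhiCDF := by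
  have h (x : ℝ) : stdPhiCDF x = stdPhiCDF 0 + ∫ t in (0:ℝ)..x, stdPhi t := by
    rw [← intervalIntegral.integral_Iic_sub_Iic integrable_stdPhi.integrableOn
      integrable_stdPhi.integrableOn]
    simp [stdPhiCDF]
  rw [funext h]
  exact continuous_const.add
    (intervalIntegral.continuous_primitive (fun _ _ => integrable_stdPhi.intervalIntegrable) 0)

lemma stdPhiCDF_neg (x : ℝ) : stdPhiCDF (-x) = 1 - stdPhiCDF x := by
  have h₁ : stdPhiCDF (-x) = ∫ t in Set.Ioi x, stdPhi t := by
    have := integral_comp_neg_Iic (-x) stdPhi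
    simpa [stdPhi_neg, stdPhiCDF] using this
  have h₂ := intervalIntegral.integral_Iic_add_Ioi (b := x)
    integrable_stdPhi.integrableOn integrable_stdPhi.integrableOn
  rw [integral_stdPhi] at h₂
  rw [h₁, stdPhiCDF]
  linarith

/-- The integral of a periodic function over one period is invariant under translation. -/
lemma Function.Periodic.intervalIntegral_comp_add_right {f : ℝ → ℝ} {T : ℝ}
    (hf : Function.Periodic f T) (c : ℝ) :
    ∫ x in (0:ℝ)..T, f (x + c) = ∫ x in (0:ℝ)..T, f x := by
  rw [intervalIntegral.integral_comp_add_right, add_comm T c, zero_add,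
    hf.intervalIntegral_add_eq c 0, zero_add]

/-- Doubling the argument does not change the integral of a periodic function over one period. -/
lemma Function.Periodic.intervalIntegral_comp_two_mul {f : ℝ → ℝ} {T : ℝ}
    (hf : Function.Periodic f T) (hc : Continuous f) :
    ∫ x in (0:ℝ)..T, f (2 * x) = ∫ x in (0:ℝ)..T, f x := by
  rw [intervalIntegral.integral_comp_mul_left f two_ne_zero]
  have h := hf.intervalIntegral_add_eq_add 0 T (fun _ _ => hc.intervalIntegrable _ _)
  rw [zero_add] at h
  rw [mul_zero, two_mul, h, smul_eq_mul]
  ring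

lemma integral_exp_mul_cos (ρ : ℝ) :
    ∫ y in (0:ℝ)..(2 * Real.pi), Real.exp (ρ * Real.cos y) = 2 * Real.pi * besselI 0 ρ := by
  rw [besselI, ← mul_assoc, mul_one_div_cancel (by positivity)]
  simp

lemma integral_cos_mul_exp_mul_cos (ρ : ℝ) :
    ∫ y in (0:ℝ)..(2 * Real.pi), Real.cos y * Real.exp (ρ * Real.cos y)
      = 2 * Real.pi * besselI 1 ρ := by
  rw [besselI, ← mul_assoc, mul_one_div_cancel (by positivity)]
  simp

lemma integral_sin_mul_exp_mul_cos (ρ : ℝ) :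
    ∫ y in (0:ℝ)..(2 * Real.pi), Real.sin y * Real.exp (ρ * Real.cos y) = 0 := by
  have h := intervalIntegral.integral_comp_sub_left (a := 0) (b := 2 * Real.pi)
    (fun y => Real.sin y * Real.exp (ρ * Real.cos y)) (2 * Real.pi)
  simp only [Real.sin_two_pi_sub, Real.cos_two_pi_sub, neg_mul, sub_self, sub_zero,
    intervalIntegral.integral_neg] at h
  linarith

lemma integral_cos_mul_vM (ρ m α : ℝ) :
    ∫ y in (0:ℝ)..(2 * Real.pi), Real.cos (y - α) * vM y m ρ
      = besselI 1 ρ / besselI 0 ρ * Real.cos (m - α) := by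
  have hper : Function.Periodic (fun y => Real.cos (y - α) * vM y m ρ) (2 * Real.pi) := by
    intro y
    simp only [vM, add_sub_right_comm y, Real.cos_add_two_pi]
  rw [← hper.intervalIntegral_comp_add_right m]
  have h (y : ℝ) : Real.cos (y + m - α) * vM (y + m) m ρ
      = (2 * Real.pi * besselI 0 ρ)⁻¹ *
        (Real.cos (m - α) * (Real.cos y * Real.exp (ρ * Real.cos y))
          - Real.sin (m - α) * (Real.sin y * Real.exp (ρ * Real.cos y))) := by
    rw [vM, add_sub_cancel_right, add_sub_assoc, Real.cos_add]
    ring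
  simp only [h]
  rw [intervalIntegral.integral_const_mul, intervalIntegral.integral_sub
      (Continuous.intervalIntegrable (by fun_prop) _ _)
      (Continuous.intervalIntegrable (by fun_prop) _ _),
    intervalIntegral.integral_const_mul, intervalIntegral.integral_const_mul,
    integral_cos_mul_exp_mul_cos, integral_sin_mul_exp_mul_cos]
  have := Real.pi_ne_zero
  field_simp
  ring

lemma integral_cos_sq_mul_stdPhi (k : ℝ) :
    ∫ u in (0:ℝ)..(2 * Real.pi), Real.cos u ^ 2 * stdPhi (k * Real.sin u)
      = (√(2 * Real.pi))⁻¹ * Real.pi * Real.exp (-(k ^ 2 / 4)) *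
          (besselI 0 (k ^ 2 / 4) + besselI 1 (k ^ 2 / 4)) := by
  set β := k ^ 2 / 4 with hβ
  let f : ℝ → ℝ := fun v => (√(2 * Real.pi))⁻¹ * Real.exp (-β) / 2 *
    (Real.exp (β * Real.cos v) + Real.cos v * Real.exp (β * Real.cos v))
  have h (u : ℝ) : Real.cos u ^ 2 * stdPhi (k * Real.sin u) = f (2 * u) := by
    have he : -(k * Real.sin u) ^ 2 / 2 = -β + β * Real.cos (2 * u) := by
      rw [Real.cos_two_mul, Real.cos_sq', hβ]
      ring
    simp only [f, stdPhi]
    rw [he, Real.exp_add, Real.cos_sq]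
    ring
  have hper : Function.Periodic f (2 * Real.pi) := fun v => by simp [f]
  simp only [h]
  rw [hper.intervalIntegral_comp_two_mul (by fun_prop)]
  simp only [f]
  rw [intervalIntegral.integral_const_mul, intervalIntegral.integral_add
      (Continuous.intervalIntegrable (by fun_prop) _ _)
      (Continuous.intervalIntegrable (by fun_prop) _ _),
    integral_cos_mul_exp_mul_cos, integral_exp_mul_cos]
  ring

lemma integral_cos_sq_mul_stdPhi_mul_stdPhiCDF (k : ℝ) :
    ∫ u in (0:ℝ)..(2 * Real.pi),
        Real.cos u ^ 2 * stdPhi (k * Real.sin u) * stdPhiCDF (k * Real.cos u)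
      = (∫ u in (0:ℝ)..(2 * Real.pi), Real.cos u ^ 2 * stdPhi (k * Real.sin u)) / 2 := by
  have hper : Function.Periodic (fun u =>
      Real.cos u ^ 2 * stdPhi (k * Real.sin u) * stdPhiCDF (k * Real.cos u)) (2 * Real.pi) :=
    fun u => by simp
  have h := hper.intervalIntegral_comp_add_right Real.pi
  simp only [Real.cos_add_pi, Real.sin_add_pi, neg_sq, mul_neg, stdPhi_neg, stdPhiCDF_neg,
    mul_sub, mul_one] at h
  rw [intervalIntegral.integral_sub
    (Continuous.intervalIntegrable (by fun_prop) _ _)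
    (Continuous.intervalIntegrable (by fun_prop) _ _)] at h
  linarith

lemma stdPhi_mul_sin_mul_stdPhi_mul_cos (k u : ℝ) :
    stdPhi (k * Real.sin u) * stdPhi (k * Real.cos u) = stdPhi 0 * stdPhi k := by
  have he : -(k * Real.sin u) ^ 2 / 2 + -(k * Real.cos u) ^ 2 / 2 = -k ^ 2 / 2 := by
    linear_combination (-k ^ 2 / 2) * Real.sin_sq_add_cos_sq u
  simp only [stdPhi]
  rw [mul_mul_mul_comm, ← Real.exp_add, he]
  simp
  ring

@[fun_prop]
lemma continuous_projNormal (μ₀ α σ : ℝ) : Continuous (projNormal μ₀ α σ) := by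
  unfold projNormal
  fun_prop

lemma integral_cos_mul_projNormal (μ₀ α σ : ℝ) :
    ∫ m in (0:ℝ)..(2 * Real.pi), Real.cos (m - α) * projNormal μ₀ α σ m
      = (μ₀ / σ) / 2 * ((√(2 * Real.pi))⁻¹ * Real.pi * Real.exp (-((μ₀ / σ) ^ 2 / 4)) *
          (besselI 0 ((μ₀ / σ) ^ 2 / 4) + besselI 1 ((μ₀ / σ) ^ 2 / 4))) := by
  have hper : Function.Periodic (fun m => Real.cos (m - α) * projNormal μ₀ α σ m)
      (2 * Real.pi) := by
    intro m
    simp only [projNormal, add_sub_right_comm m, Real.cos_add_two_pi, Real.sin_add_two_pi]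
  rw [← hper.intervalIntegral_comp_add_right α]
  set k := μ₀ / σ with hk
  have h (u : ℝ) : Real.cos (u + α - α) * projNormal μ₀ α σ (u + α)
      = stdPhi 0 * stdPhi k * Real.cos u
        + k * (Real.cos u ^ 2 * stdPhi (k * Real.sin u) * stdPhiCDF (k * Real.cos u)) := by
    rw [← stdPhi_mul_sin_mul_stdPhi_mul_cos k u, projNormal, add_sub_cancel_right,
      mul_div_right_comm, mul_div_right_comm, ← hk]
    ring
  simp only [h]
  rw [intervalIntegral.integral_add
      (Continuous.intervalIntegrable (by fun_prop) _ _)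
      (Continuous.intervalIntegrable (by fun_prop) _ _),
    intervalIntegral.integral_const_mul, intervalIntegral.integral_const_mul, integral_cos,
    integral_cos_sq_mul_stdPhi_mul_stdPhiCDF, integral_cos_sq_mul_stdPhi]
  simp
  ring

theorem stmt_5 (ρ σ μ₀ αμ : ℝ) (hρ : 0 < ρ) (hσ : 0 < σ) (hμ₀ : 0 ≤ μ₀)
    (β : ℝ) (hβ : β = μ₀ ^ 2 / (4 * σ ^ 2)) :
    (∫ y in (0:ℝ)..(2 * Real.pi), ∫ m in (0:ℝ)..(2 * Real.pi),
        Real.cos (y - αμ) * vM y m ρ * projNormal μ₀ αμ σ m)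
      = (besselI 1 ρ / besselI 0 ρ) * Real.sqrt (Real.pi * β / 2) * Real.exp (-β) *
          (besselI 0 β + besselI 1 β) := by
  have hcont : Continuous (Function.uncurry fun y m =>
      Real.cos (y - αμ) * vM y m ρ * projNormal μ₀ αμ σ m) := by
    unfold vM Function.uncurry
    fun_prop
  have hswap := intervalIntegral_intervalIntegral_swap
    (a := 0) (b := 2 * Real.pi) (c := 0) (d := 2 * Real.pi)
    ((hcont.continuousOn.integrableOn_compact
      (isCompact_uIcc.prod isCompact_uIcc)).mono_set
      (Set.prod_mono Set.uIoc_subset_uIcc Set.uIoc_subset_uIcc))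
  rw [hswap]
  simp only [intervalIntegral.integral_mul_const, integral_cos_mul_vM]
  simp only [mul_assoc (besselI 1 ρ / besselI 0 ρ)]
  rw [intervalIntegral.integral_const_mul, integral_cos_mul_projNormal]
  have hβk : (μ₀ / σ) ^ 2 / 4 = β := by
    rw [hβ]
    field_simp
  have hsqrt : √(Real.pi * β / 2) = (μ₀ / σ) / 2 * ((√(2 * Real.pi))⁻¹ * Real.pi) := by
    have hsq : Real.pi * β / 2 = ((μ₀ / σ) / 2 * ((√(2 * Real.pi))⁻¹ * Real.pi)) ^ 2 := by
      have := Real.pi_ne_zero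
      rw [← hβk, mul_pow, mul_pow, inv_pow, Real.sq_sqrt (by positivity)]
      field_simp
      norm_num
    rw [hsq, Real.sqrt_sq (by positivity)]
  rw [hβk, hsqrt]
  ring
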